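/- Let X, Y, Z > 0, 0 < α < β < 1 and φ₁, φ₂ ∈ (−π, π). Then, as ε → 0+, ∫₀^{∞}∫₀^{∞} V(ε, −u₁, −u₂) du₁ du₂ = ∫₀^{∞}∫₀^{∞} V(0, −u₁, −u₂) du₁ du₂ + Γ(−α) ( ∫₀^{∞} (Z e^{u} + X)^{α} exp(−Y e^{−u}) · e^{−βu}/(1 + e^{−u + iφ₂}) du ) ε^{α} + O(ε^{β}). -/

import Mathlib

/-- The function `V(ε,u₁,u₂)` from Appendix B:
`V(ε,u₁,u₂) = exp(−(Xe^{u₁}+Ye^{u₂}+Ze^{u₁+u₂}) − 2ε(X cosh u₁ + Y cosh u₂ + Z cosh(u₁+u₂)))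
  · e^{αu₁+βu₂} / ((1+e^{u₁+iφ₁})(1+e^{u₂+iφ₂}))`. -/
noncomputable def Vfun (X Y Z α β φ₁ φ₂ ε u₁ u₂ : ℝ) : ℂ :=
  (Real.exp (-(X * Real.exp u₁ + Y * Real.exp u₂ + Z * Real.exp (u₁ + u₂))
      - 2 * ε * (X * Real.cosh u₁ + Y * Real.cosh u₂ + Z * Real.cosh (u₁ + u₂))) : ℂ) *
    Complex.exp ((α : ℂ) * (u₁ : ℂ) + (β : ℂ) * (u₂ : ℂ)) /
      ((1 + Complex.exp ((u₁ : ℂ) + Complex.I * (φ₁ : ℂ))) *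
        (1 + Complex.exp ((u₂ : ℂ) + Complex.I * (φ₂ : ℂ))))

open MeasureTheory Set Filter Topology

theorem Real.abs_exp_neg_sub_exp_neg_le_min {a b : ℝ} (hb : 0 ≤ b) (hab : b ≤ a) :
    |Real.exp (-a) - Real.exp (-b)| ≤ min 1 (a - b) := by
  have h1 : Real.exp (-a) ≤ Real.exp (-b) := Real.exp_le_exp.2 (by linarith)
  have h2 : Real.exp (-b) ≤ 1 := Real.exp_le_one_iff.2 (by linarith)
  rw [abs_sub_comm, abs_of_nonneg (by linarith)]
  refine le_min (by linarith [Real.exp_pos (-a)]) ?_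
  have h3 : Real.exp (-a) = Real.exp (-b) * Real.exp (-(a - b)) := by
    rw [← Real.exp_add]; ring_nf
  have h4 := Real.one_sub_le_exp_neg (a - b)
  rw [h3]
  nlinarith [Real.exp_pos (-b)]

/-- The truncated exponential `x ↦ e^{-ax} min(1, e^x)`. -/
noncomputable def truncExp (a x : ℝ) : ℝ := Real.exp (-(a * x)) * min 1 (Real.exp x)

theorem truncExp_nonneg (a x : ℝ) : 0 ≤ truncExp a x :=
  mul_nonneg (Real.exp_pos _).le (le_min zero_le_one (Real.exp_pos _).le)

theorem continuous_truncExp (a : ℝ) : Continuous (truncExp a) := by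
  unfold truncExp; fun_prop

theorem integrable_truncExp {a : ℝ} (h0 : 0 < a) (h1 : a < 1) : Integrable (truncExp a) := by
  rw [← integrableOn_univ, ← Iic_union_Ioi (a := (0 : ℝ)), integrableOn_union]
  constructor
  · refine (integrableOn_exp_mul_Iic (sub_pos.2 h1) 0).mono'
      (continuous_truncExp a).aestronglyMeasurable (Eventually.of_forall fun x => ?_)
    rw [Real.norm_of_nonneg (truncExp_nonneg a x), sub_mul, one_mul, sub_eq_neg_add, Real.exp_add]
    exact mul_le_mul_of_nonneg_left (min_le_right _ _) (Real.exp_pos _).le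
  · refine (integrableOn_exp_mul_Ioi (neg_lt_zero.2 h0) 0).mono'
      (continuous_truncExp a).aestronglyMeasurable (Eventually.of_forall fun x => ?_)
    rw [Real.norm_of_nonneg (truncExp_nonneg a x), neg_mul]
    exact mul_le_of_le_one_right (Real.exp_pos _).le (min_le_left _ _)

theorem exp_neg_mul_min_eq_rpow_mul_truncExp (a x : ℝ) {c : ℝ} (hc : 0 < c) :
    Real.exp (-(a * x)) * min 1 (c * Real.exp x) = c ^ a * truncExp a (x + Real.log c) := by
  rw [truncExp, Real.exp_add, Real.exp_log hc, Real.rpow_def_of_pos hc, ← mul_assoc,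
    ← Real.exp_add, mul_comm c]
  ring_nf

theorem integrable_exp_neg_mul_min {a c : ℝ} (h0 : 0 < a) (h1 : a < 1) (hc : 0 < c) :
    Integrable fun x : ℝ => Real.exp (-(a * x)) * min 1 (c * Real.exp x) := by
  simp_rw [exp_neg_mul_min_eq_rpow_mul_truncExp a _ hc]
  exact ((integrable_truncExp h0 h1).comp_add_right _).const_mul _

theorem setIntegral_exp_neg_mul_min_le {a c : ℝ} (h0 : 0 < a) (h1 : a < 1) (hc : 0 < c)
    (s : Set ℝ) :
    ∫ x in s, Real.exp (-(a * x)) * min 1 (c * Real.exp x) ≤ c ^ a * ∫ x, truncExp a x := by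
  have h := setIntegral_le_integral (s := s) (integrable_exp_neg_mul_min h0 h1 hc)
    (Eventually.of_forall fun x =>
      mul_nonneg (Real.exp_pos _).le (le_min zero_le_one (by positivity)))
  refine h.trans (le_of_eq ?_)
  simp_rw [exp_neg_mul_min_eq_rpow_mul_truncExp a _ hc]
  rw [integral_const_mul, integral_add_right_eq_self (truncExp a)]

theorem abs_exp_neg_mul_exp_sub_one_le (a p : ℝ) {c : ℝ} (hc : 0 ≤ c) :
    |Real.exp (-(a * p)) * (Real.exp (-(c * Real.exp p)) - 1)| ≤
      Real.exp (-(a * p)) * min 1 (c * Real.exp p) := by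
  rw [abs_mul, abs_of_pos (Real.exp_pos _)]
  refine mul_le_mul_of_nonneg_left ?_ (Real.exp_pos _).le
  simpa using Real.abs_exp_neg_sub_exp_neg_le_min (a := c * Real.exp p) (b := 0) le_rfl
    (by positivity)

theorem integrable_exp_neg_mul_exp_sub_one {a c : ℝ} (h0 : 0 < a) (h1 : a < 1) (hc : 0 < c) :
    Integrable fun p : ℝ => Real.exp (-(a * p)) * (Real.exp (-(c * Real.exp p)) - 1) :=
  (integrable_exp_neg_mul_min h0 h1 hc).mono' (by fun_prop)
    (Eventually.of_forall fun p => abs_exp_neg_mul_exp_sub_one_le a p hc.le)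

theorem exp_image_univ : Real.exp '' univ = Ioi 0 := by
  rw [image_univ, Real.range_exp]

theorem integrable_exp_mul_exp_neg_exp {s : ℝ} (hs : 0 < s) :
    Integrable fun p : ℝ => Real.exp (s * p) * Real.exp (-Real.exp p) := by
  have h := Real.GammaIntegral_convergent hs
  rw [← exp_image_univ, integrableOn_image_iff_integrableOn_abs_deriv_smul MeasurableSet.univ
    (fun x _ => (Real.hasDerivAt_exp x).hasDerivWithinAt) Real.exp_injective.injOn,
    integrableOn_univ] at h
  refine h.congr (Eventually.of_forall fun p => ?_)
  simp only [smul_eq_mul, abs_of_pos (Real.exp_pos p), ← Real.exp_mul, ← Real.exp_add]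
  ring_nf

theorem integral_exp_mul_exp_neg_exp {s : ℝ} (hs : 0 < s) :
    ∫ p : ℝ, Real.exp (s * p) * Real.exp (-Real.exp p) = Real.Gamma s := by
  rw [Real.Gamma_eq_integral hs, ← exp_image_univ,
    integral_image_eq_integral_abs_deriv_smul MeasurableSet.univ
    (fun x _ => (Real.hasDerivAt_exp x).hasDerivWithinAt) Real.exp_injective.injOn,
    setIntegral_univ]
  refine integral_congr_ae (Eventually.of_forall fun p => ?_)
  simp only [smul_eq_mul, abs_of_pos (Real.exp_pos p), ← Real.exp_mul, ← Real.exp_add]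
  ring_nf

theorem integral_exp_neg_mul_exp_sub_one_of_one {a : ℝ} (h0 : 0 < a) (h1 : a < 1) :
    ∫ p : ℝ, Real.exp (-(a * p)) * (Real.exp (-Real.exp p) - 1) = Real.Gamma (-a) := by
  have hI : Integrable fun p : ℝ => Real.exp (-(a * p)) * (Real.exp (-Real.exp p) - 1) := by
    simpa using integrable_exp_neg_mul_exp_sub_one h0 h1 one_pos
  have hG := integrable_exp_mul_exp_neg_exp (sub_pos.2 h1)
  have hexp : ∀ p : ℝ, Real.exp ((1 - a) * p) = Real.exp p * Real.exp (-(a * p)) := fun p => by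
    rw [← Real.exp_add]; ring_nf
  have key := integral_mul_deriv_eq_deriv_mul_of_integrable
    (u := fun p : ℝ => Real.exp (-Real.exp p) - 1)
    (u' := fun p : ℝ => -(Real.exp p * Real.exp (-Real.exp p)))
    (v := fun p : ℝ => -Real.exp (-(a * p)) / a) (v' := fun p : ℝ => Real.exp (-(a * p)))
    (fun p _ => by
      simpa [mul_comm] using (Real.hasDerivAt_exp p).fun_neg.exp.sub_const 1)
    (fun p _ => by
      simpa [h0.ne'] using ((hasDerivAt_id p).const_mul a).fun_neg.exp.fun_neg.div_const a)
    (hI.congr (Eventually.of_forall fun p => by simp; ring))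
    ((hG.div_const a).congr (Eventually.of_forall fun p => by
      simp only [hexp, Pi.mul_apply]; ring))
    ((hI.div_const (-a)).congr (Eventually.of_forall fun p => by
      simp only [Pi.mul_apply]; field_simp))
  have h2 : ∀ p : ℝ, -(Real.exp p * Real.exp (-Real.exp p)) * (-Real.exp (-(a * p)) / a) =
      Real.exp ((1 - a) * p) * Real.exp (-Real.exp p) / a := fun p => by
    rw [hexp]; ring
  simp_rw [h2, integral_div, integral_exp_mul_exp_neg_exp (sub_pos.2 h1)] at key
  have h3 := Real.Gamma_add_one (s := -a) (by linarith)
  rw [neg_add_eq_sub] at h3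
  simp_rw [mul_comm (Real.exp (-(a * _)))]
  rw [key, h3]
  field_simp

theorem integral_exp_neg_mul_exp_sub_one {a c : ℝ} (h0 : 0 < a) (h1 : a < 1) (hc : 0 < c) :
    ∫ p : ℝ, Real.exp (-(a * p)) * (Real.exp (-(c * Real.exp p)) - 1) =
      Real.Gamma (-a) * c ^ a := by
  have h : ∀ p : ℝ, Real.exp (-(a * p)) * (Real.exp (-(c * Real.exp p)) - 1) =
      c ^ a * (Real.exp (-(a * (p + Real.log c))) *
        (Real.exp (-Real.exp (p + Real.log c)) - 1)) := fun p => by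
    rw [Real.exp_add, Real.exp_log hc, Real.rpow_def_of_pos hc, ← mul_assoc, ← Real.exp_add,
      mul_comm c]
    ring_nf
  simp_rw [h]
  rw [integral_const_mul, integral_add_right_eq_self
    (fun p : ℝ => Real.exp (-(a * p)) * (Real.exp (-Real.exp p) - 1)),
    integral_exp_neg_mul_exp_sub_one_of_one h0 h1, mul_comm]

theorem min_one_le_rpow {x γ : ℝ} (hx : 0 < x) (h0 : 0 ≤ γ) (h1 : γ ≤ 1) : min 1 x ≤ x ^ γ := by
  rcases le_total x 1 with h | h
  · have := Real.rpow_le_rpow_of_exponent_ge hx h h1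
    rw [Real.rpow_one] at this
    exact (min_le_right _ _).trans this
  · exact (min_le_left _ _).trans (Real.one_le_rpow h h0)

theorem Continuous.integrable_uncurry_of_norm_le_mul {s t : Set ℝ} (hs : MeasurableSet s)
    (ht : MeasurableSet t) {f : ℝ → ℝ → ℂ} (hf : Continuous (Function.uncurry f)) {w v : ℝ → ℝ}
    (hw : IntegrableOn w s) (hv : IntegrableOn v t)
    (h : ∀ p ∈ s, ∀ q ∈ t, ‖f p q‖ ≤ w p * v q) :
    Integrable (Function.uncurry f) ((volume.restrict s).prod (volume.restrict t)) := by
  refine (hw.mul_prod hv).mono' hf.aestronglyMeasurable ?_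
  rw [Measure.prod_restrict]
  exact ae_restrict_of_forall_mem (hs.prod ht) fun z hz => h z.1 hz.1 z.2 hz.2

theorem norm_setIntegral_setIntegral_le_rpow {s : Set ℝ} (hs : MeasurableSet s) {G : ℝ → ℝ → ℂ}
    {a ε : ℝ} (h0 : 0 < a) (h1 : a < 1) (hε : 0 < ε) {w k : ℝ → ℝ} (hw : ∀ p, 0 ≤ w p)
    (hk : ∀ p, 0 < k p) (hwk : IntegrableOn (fun p => w p * k p ^ a) s)
    (hG : ∀ p ∈ s, ∀ q ∈ Ioi (0 : ℝ),
      ‖G p q‖ ≤ w p * (Real.exp (-(a * q)) * min 1 (ε * k p * Real.exp q))) :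
    ‖∫ p in s, ∫ q in Ioi (0 : ℝ), G p q‖ ≤
      ((∫ x, truncExp a x) * ∫ p in s, w p * k p ^ a) * ε ^ a := by
  refine (norm_integral_le_of_norm_le (hwk.mul_const ((∫ x, truncExp a x) * ε ^ a))
    (ae_restrict_of_forall_mem hs fun p hp => ?_)).trans (le_of_eq ?_)
  · have hεk := mul_pos hε (hk p)
    refine (norm_integral_le_of_norm_le
      ((integrable_exp_neg_mul_min h0 h1 hεk).integrableOn.const_mul (w p))
      (ae_restrict_of_forall_mem measurableSet_Ioi fun q hq => hG p hp q hq)).trans ?_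
    rw [integral_const_mul]
    refine (mul_le_mul_of_nonneg_left (setIntegral_exp_neg_mul_min_le h0 h1 hεk _)
      (hw p)).trans (le_of_eq ?_)
    rw [Real.mul_rpow hε.le (hk p).le]
    ring
  · rw [integral_mul_const]
    ring

/-- The boundary profile with its two-dimensional kernel,
`b(q) e^{-βq} e^{-αp} (exp(-ε(X + Ze^q)e^p) - 1)`. -/
noncomputable def boundaryKernel (X Z α β ε : ℝ) (b : ℝ → ℂ) (p q : ℝ) : ℂ :=
  b q * ((Real.exp (-(β * q)) *
    (Real.exp (-(α * p)) * (Real.exp (-(ε * (X + Z * Real.exp q) * Real.exp p)) - 1)) : ℝ) : ℂ)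

section BoundaryKernel

variable {X Z α β ε B : ℝ} {b : ℝ → ℂ}

theorem continuous_uncurry_boundaryKernel (hb : Continuous b) :
    Continuous (Function.uncurry (boundaryKernel X Z α β ε b)) := by
  unfold boundaryKernel Function.uncurry
  fun_prop

theorem norm_boundaryKernel_le (hX : 0 < X) (hZ : 0 < Z) (hε : 0 < ε) (hB : ∀ q, ‖b q‖ ≤ B)
    (p : ℝ) {q : ℝ} (hq : 0 < q) :
    ‖boundaryKernel X Z α β ε b p q‖ ≤ B * Real.exp (-(α * p)) *
      (Real.exp (-(β * q)) * min 1 (ε * ((X + Z) * Real.exp p) * Real.exp q)) := by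
  have hB0 : 0 ≤ B := (norm_nonneg _).trans (hB q)
  have hq1 : 1 ≤ Real.exp q := Real.one_le_exp hq.le
  have hmin : min 1 (ε * (X + Z * Real.exp q) * Real.exp p) ≤
      min 1 (ε * ((X + Z) * Real.exp p) * Real.exp q) := by
    refine min_le_min_left _ ?_
    have : X + Z * Real.exp q ≤ (X + Z) * Real.exp q := by nlinarith
    calc ε * (X + Z * Real.exp q) * Real.exp p ≤ ε * ((X + Z) * Real.exp q) * Real.exp p := by
          gcongr
      _ = _ := by ring
  have h := abs_exp_neg_mul_exp_sub_one_le α p (c := ε * (X + Z * Real.exp q)) (by positivity)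
  rw [boundaryKernel, norm_mul, Complex.norm_real, norm_mul, Real.norm_of_nonneg (Real.exp_pos _).le,
    Real.norm_eq_abs]
  calc _ ≤ B * (Real.exp (-(β * q)) * (Real.exp (-(α * p)) *
        min 1 (ε * ((X + Z) * Real.exp p) * Real.exp q))) := by
        gcongr
        · exact hB q
        · exact h.trans (by gcongr)
    _ = _ := by ring

theorem integrable_boundaryKernel_Ioi (hX : 0 < X) (hZ : 0 < Z) (hα : 0 < α) (hβ : 0 < β)
    (hε : 0 < ε) (hb : Continuous b) (hB : ∀ q, ‖b q‖ ≤ B) :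
    Integrable (Function.uncurry (boundaryKernel X Z α β ε b))
      ((volume.restrict (Ioi 0)).prod (volume.restrict (Ioi 0))) := by
  have hB0 : 0 ≤ B := (norm_nonneg _).trans (hB 0)
  refine (continuous_uncurry_boundaryKernel hb).integrable_uncurry_of_norm_le_mul
    measurableSet_Ioi measurableSet_Ioi
    ((integrableOn_exp_mul_Ioi (neg_lt_zero.2 hα) 0).const_mul B)
    (integrableOn_exp_mul_Ioi (neg_lt_zero.2 hβ) 0) fun p _ q hq => ?_
  refine (norm_boundaryKernel_le hX hZ hε hB p hq).trans ?_
  rw [neg_mul, neg_mul]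
  refine mul_le_mul_of_nonneg_left ?_ (by positivity)
  exact mul_le_of_le_one_right (Real.exp_pos _).le (min_le_left _ _)

theorem integrable_boundaryKernel_Iic (hX : 0 < X) (hZ : 0 < Z) (hα : 0 < α) (hαβ : α < β)
    (hβ : β < 1) (hε : 0 < ε) (hb : Continuous b) (hB : ∀ q, ‖b q‖ ≤ B) :
    Integrable (Function.uncurry (boundaryKernel X Z α β ε b))
      ((volume.restrict (Iic 0)).prod (volume.restrict (Ioi 0))) := by
  have hB0 : 0 ≤ B := (norm_nonneg _).trans (hB 0)
  obtain ⟨γ, hαγ, hγβ⟩ := exists_between hαβ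
  refine (continuous_uncurry_boundaryKernel hb).integrable_uncurry_of_norm_le_mul
    measurableSet_Iic measurableSet_Ioi
    ((integrableOn_exp_mul_Iic (sub_pos.2 hαγ) 0).const_mul (B * (ε * (X + Z)) ^ γ))
    (integrableOn_exp_mul_Ioi (sub_neg.2 hγβ) 0) fun p _ q hq => ?_
  refine (norm_boundaryKernel_le hX hZ hε hB p hq).trans ?_
  have h := min_one_le_rpow (x := ε * ((X + Z) * Real.exp p) * Real.exp q) (γ := γ)
    (by positivity) (by linarith) (by linarith)
  have h2 : (ε * ((X + Z) * Real.exp p) * Real.exp q) ^ γ =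
      (ε * (X + Z)) ^ γ * Real.exp (p * γ) * Real.exp (q * γ) := by
    rw [← mul_assoc, Real.mul_rpow (by positivity) (by positivity),
      Real.mul_rpow (by positivity) (by positivity), Real.exp_mul, Real.exp_mul]
  calc _ ≤ B * Real.exp (-(α * p)) * (Real.exp (-(β * q)) *
        ((ε * (X + Z)) ^ γ * Real.exp (p * γ) * Real.exp (q * γ))) := by
        rw [← h2]; gcongr
    _ = B * (ε * (X + Z)) ^ γ * (Real.exp (-(α * p)) * Real.exp (p * γ)) *
        (Real.exp (-(β * q)) * Real.exp (q * γ)) := by ring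
    _ = _ := by
        rw [← Real.exp_add, ← Real.exp_add]
        ring_nf

theorem integral_boundaryKernel (hX : 0 < X) (hZ : 0 < Z) (hα : 0 < α) (hα1 : α < 1)
    (hε : 0 < ε) (q : ℝ) :
    ∫ p, boundaryKernel X Z α β ε b p q =
      ((Real.Gamma (-α) : ℝ) : ℂ) * ((((Z * Real.exp q + X) ^ α : ℝ) : ℂ) * b q *
        (Real.exp (-(β * q)) : ℂ)) * ((ε ^ α : ℝ) : ℂ) := by
  have hc : 0 < X + Z * Real.exp q := by positivity
  simp only [boundaryKernel]
  rw [integral_const_mul, integral_complex_ofReal, integral_const_mul,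
    integral_exp_neg_mul_exp_sub_one hα hα1 (mul_pos hε hc), Real.mul_rpow hε.le hc.le, add_comm X]
  push_cast
  ring

theorem integrable_boundaryKernel_left (hX : 0 < X) (hZ : 0 < Z) (hα : 0 < α) (hα1 : α < 1)
    (hε : 0 < ε) (q : ℝ) : Integrable fun p => boundaryKernel X Z α β ε b p q := by
  have hc : 0 < X + Z * Real.exp q := by positivity
  exact (((integrable_exp_neg_mul_exp_sub_one hα hα1 (mul_pos hε hc)).const_mul _).ofReal).const_mul _

theorem setIntegral_boundaryKernel_add (hX : 0 < X) (hZ : 0 < Z) (hα : 0 < α) (hαβ : α < β)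
    (hβ : β < 1) (hε : 0 < ε) (hb : Continuous b) (hB : ∀ q, ‖b q‖ ≤ B) :
    (∫ p in Ioi (0 : ℝ), ∫ q in Ioi (0 : ℝ), boundaryKernel X Z α β ε b p q) +
      (∫ p in Iic (0 : ℝ), ∫ q in Ioi (0 : ℝ), boundaryKernel X Z α β ε b p q) =
    ((Real.Gamma (-α) : ℝ) : ℂ) * (∫ q in Ioi (0 : ℝ),
      (((Z * Real.exp q + X) ^ α : ℝ) : ℂ) * b q * (Real.exp (-(β * q)) : ℂ)) *
      ((ε ^ α : ℝ) : ℂ) := by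
  have h1 := integrable_boundaryKernel_Ioi hX hZ hα (hα.trans hαβ) hε hb hB
  have h2 := integrable_boundaryKernel_Iic hX hZ hα hαβ hβ hε hb hB
  have h1' : IntegrableOn (fun q => ∫ p in Ioi (0 : ℝ), boundaryKernel X Z α β ε b p q) (Ioi 0) :=
    h1.integral_prod_right
  have h2' : IntegrableOn (fun q => ∫ p in Iic (0 : ℝ), boundaryKernel X Z α β ε b p q) (Ioi 0) :=
    h2.integral_prod_right
  rw [integral_integral_swap h1, integral_integral_swap h2, ← integral_add h1' h2', ← integral_const_mul, ← integral_mul_const]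
  refine integral_congr_ae (Eventually.of_forall fun q => ?_)
  have h3 := integrable_boundaryKernel_left (β := β) (b := b) hX hZ hα (hαβ.trans hβ) hε q
  beta_reduce
  rw [add_comm, intervalIntegral.integral_Iic_add_Ioi h3.integrableOn h3.integrableOn,
    integral_boundaryKernel hX hZ hα (hαβ.trans hβ) hε]

end BoundaryKernel

theorem setIntegral_setIntegral_eq_add {s t : Set ℝ} {f f₁ f₂ f₃ f₄ : ℝ → ℝ → ℂ}
    (hf : ∀ p q, f p q = f₁ p q + f₂ p q + f₃ p q + f₄ p q)
    (h₁ : Integrable (Function.uncurry f₁) ((volume.restrict s).prod (volume.restrict t)))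
    (h₂ : Integrable (Function.uncurry f₂) ((volume.restrict s).prod (volume.restrict t)))
    (h₃ : Integrable (Function.uncurry f₃) ((volume.restrict s).prod (volume.restrict t)))
    (h₄ : Integrable (Function.uncurry f₄) ((volume.restrict s).prod (volume.restrict t))) :
    ∫ p in s, ∫ q in t, f p q = (∫ p in s, ∫ q in t, f₁ p q) + (∫ p in s, ∫ q in t, f₂ p q) +
      (∫ p in s, ∫ q in t, f₃ p q) + ∫ p in s, ∫ q in t, f₄ p q := by
  have hfe : Function.uncurry f = fun z => Function.uncurry f₁ z + Function.uncurry f₂ z +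
      Function.uncurry f₃ z + Function.uncurry f₄ z := funext fun z => hf z.1 z.2
  have h : Integrable (Function.uncurry f) ((volume.restrict s).prod (volume.restrict t)) := by
    rw [hfe]; exact ((h₁.add h₂).add h₃).add h₄
  rw [integral_integral h, integral_integral h₁, integral_integral h₂, integral_integral h₃,
    integral_integral h₄]
  simp_rw [hf]
  exact (integral_add ((h₁.add h₂).add h₃) h₄).trans (congrArg (· + _)
    ((integral_add (h₁.add h₂) h₃).trans (congrArg (· + _) (integral_add h₁ h₂))))

/-- Small-`ε` asymptotics of `∫∫ F(p,q) e^{-αp-βq} e^{-εA(p,q)}` when `A(p,q)` is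
`(X + Ze^q)e^p` up to `O(e^q)` and `F(p,q)` is `b(q)` up to `O(e^{-p})`. -/
theorem exists_norm_setIntegral_sub_boundary_le {X Z α β B D K : ℝ} (hX : 0 < X) (hZ : 0 < Z)
    (hα : 0 < α) (hαβ : α < β) (hβ : β < 1) (hD : 0 ≤ D) (hK : 0 < K) {F : ℝ → ℝ → ℂ}
    {A : ℝ → ℝ → ℝ} {b : ℝ → ℂ} (hF : Continuous (Function.uncurry F))
    (hA : Continuous (Function.uncurry A)) (hb : Continuous b) (hFB : ∀ p q, ‖F p q‖ ≤ B)
    (hbB : ∀ q, ‖b q‖ ≤ B)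
    (hFb : ∀ p ∈ Ioi (0 : ℝ), ∀ q ∈ Ioi (0 : ℝ), ‖F p q - b q‖ ≤ D * Real.exp (-p))
    (hA_lower : ∀ p q, (X + Z * Real.exp q) * Real.exp p ≤ A p q)
    (hA_upper : ∀ p ∈ Ioi (0 : ℝ), ∀ q ∈ Ioi (0 : ℝ),
      A p q ≤ (X + Z * Real.exp q) * Real.exp p + K * Real.exp q) :
    ∃ C : ℝ, ∀ ε : ℝ, 0 < ε →
      ‖(∫ p in Ioi (0 : ℝ), ∫ q in Ioi (0 : ℝ), F p q *
            ((Real.exp (-(α * p)) * Real.exp (-(β * q)) * Real.exp (-(ε * A p q)) : ℝ) : ℂ))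
          - (∫ p in Ioi (0 : ℝ), ∫ q in Ioi (0 : ℝ), F p q *
            ((Real.exp (-(α * p)) * Real.exp (-(β * q)) : ℝ) : ℂ))
          - ((Real.Gamma (-α) : ℝ) : ℂ) * (∫ q in Ioi (0 : ℝ),
            (((Z * Real.exp q + X) ^ α : ℝ) : ℂ) * b q * (Real.exp (-(β * q)) : ℂ)) *
            ((ε ^ α : ℝ) : ℂ)‖ ≤ C * ε ^ β := by
  have hB : 0 ≤ B := (norm_nonneg _).trans (hbB 0)
  have hβ0 := hα.trans hαβ
  have hXZ : 0 < X + Z := add_pos hX hZ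
  have hwα : IntegrableOn (fun p : ℝ => B * Real.exp (-(α * p))) (Ioi 0) := by
    simpa only [neg_mul, IntegrableOn] using
      (integrableOn_exp_mul_Ioi (neg_lt_zero.2 hα) 0).const_mul B
  have hwα' : IntegrableOn (fun p : ℝ => D * Real.exp (-p) * Real.exp (-(α * p))) (Ioi 0) := by
    refine ((integrableOn_exp_mul_Ioi (a := -1 - α) (by linarith) 0).const_mul D).congr
      (Eventually.of_forall fun p => ?_)
    simp only
    rw [mul_assoc, ← Real.exp_add]
    ring_nf
  have hvβ : IntegrableOn (fun q : ℝ => Real.exp (-(β * q))) (Ioi 0) := by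
    simpa only [neg_mul] using integrableOn_exp_mul_Ioi (neg_lt_zero.2 hβ0) 0
  have hrpow : ∀ p : ℝ, ((X + Z) * Real.exp p) ^ β = (X + Z) ^ β * Real.exp (β * p) := fun p => by
    rw [Real.mul_rpow hXZ.le (Real.exp_pos _).le, mul_comm β, Real.exp_mul]
  set M := ∫ x, truncExp β x
  refine ⟨M * (∫ p in Ioi (0 : ℝ), B * Real.exp (-(α * p)) * K ^ β) +
    M * (∫ p in Ioi (0 : ℝ),
      D * Real.exp (-p) * Real.exp (-(α * p)) * ((X + Z) * Real.exp p) ^ β) +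
    M * (∫ p in Iic (0 : ℝ), B * Real.exp (-(α * p)) * ((X + Z) * Real.exp p) ^ β),
    fun ε hε => ?_⟩
  set W₀ : ℝ → ℝ → ℂ := fun p q => F p q * ((Real.exp (-(α * p)) * Real.exp (-(β * q)) : ℝ) : ℂ)
  set G₁ : ℝ → ℝ → ℂ := fun p q => F p q * ((Real.exp (-(α * p)) * (Real.exp (-(β * q)) *
    (Real.exp (-(ε * A p q)) - Real.exp (-(ε * ((X + Z * Real.exp q) * Real.exp p)))) ) : ℝ) : ℂ)
    with hG₁
  set G₂ : ℝ → ℝ → ℂ := fun p q => (F p q - b q) * ((Real.exp (-(α * p)) * (Real.exp (-(β * q)) *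
    (Real.exp (-(ε * ((X + Z * Real.exp q) * Real.exp p))) - 1)) : ℝ) : ℂ) with hG₂
  have hA0 : ∀ p q, 0 ≤ (X + Z * Real.exp q) * Real.exp p := fun p q => by positivity
  have hG₁_le : ∀ p ∈ Ioi (0 : ℝ), ∀ q ∈ Ioi (0 : ℝ), ‖G₁ p q‖ ≤
      B * Real.exp (-(α * p)) * (Real.exp (-(β * q)) * min 1 (ε * K * Real.exp q)) := by
    intro p hp q hq
    have h := Real.abs_exp_neg_sub_exp_neg_le_min (mul_nonneg hε.le (hA0 p q))
      (mul_le_mul_of_nonneg_left (hA_lower p q) hε.le)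
    have h' : ε * A p q - ε * ((X + Z * Real.exp q) * Real.exp p) ≤ ε * K * Real.exp q := by
      have := mul_le_mul_of_nonneg_left (hA_upper p hp q hq) hε.le
      linarith
    simp only [hG₁, norm_mul, Complex.norm_real, Real.norm_eq_abs, Real.abs_exp]
    rw [mul_assoc B]
    gcongr
    · exact hFB p q
    · exact h.trans (min_le_min_left _ h')
  have hG₂_le : ∀ p ∈ Ioi (0 : ℝ), ∀ q ∈ Ioi (0 : ℝ), ‖G₂ p q‖ ≤
      D * Real.exp (-p) * Real.exp (-(α * p)) *
        (Real.exp (-(β * q)) * min 1 (ε * ((X + Z) * Real.exp p) * Real.exp q)) := by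
    intro p hp q hq
    have h := Real.abs_exp_neg_sub_exp_neg_le_min le_rfl (mul_nonneg hε.le (hA0 p q))
    rw [neg_zero, Real.exp_zero, sub_zero] at h
    have hq1 : 1 ≤ Real.exp q := Real.one_le_exp (le_of_lt hq)
    have h' : ε * ((X + Z * Real.exp q) * Real.exp p) ≤
        ε * ((X + Z) * Real.exp p) * Real.exp q := by
      have : X + Z * Real.exp q ≤ (X + Z) * Real.exp q := by nlinarith
      calc _ ≤ ε * ((X + Z) * Real.exp q * Real.exp p) := by gcongr
        _ = _ := by ring
    simp only [hG₂, norm_mul, Complex.norm_real, Real.norm_eq_abs, Real.abs_exp]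
    rw [mul_assoc (D * Real.exp (-p))]
    gcongr
    · exact hFb p hp q hq
    · exact h.trans (min_le_min_left _ h')
  have hW₀i : Integrable (Function.uncurry W₀)
      ((volume.restrict (Ioi 0)).prod (volume.restrict (Ioi 0))) := by
    refine Continuous.integrable_uncurry_of_norm_le_mul measurableSet_Ioi measurableSet_Ioi
      ?_ hwα hvβ fun p _ q _ => ?_
    · exact hF.mul (by fun_prop)
    · simp only [W₀, norm_mul, Complex.norm_real, Real.norm_eq_abs, Real.abs_exp]
      rw [mul_assoc B]
      gcongr
      exact hFB p q
  have hG₁i : Integrable (Function.uncurry G₁)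
      ((volume.restrict (Ioi 0)).prod (volume.restrict (Ioi 0))) := by
    refine Continuous.integrable_uncurry_of_norm_le_mul measurableSet_Ioi measurableSet_Ioi
      ?_ hwα hvβ fun p hp q hq => (hG₁_le p hp q hq).trans ?_
    · have hA' : Continuous fun z : ℝ × ℝ => A z.1 z.2 := hA
      exact hF.mul (by fun_prop)
    · exact mul_le_mul_of_nonneg_left
        (mul_le_of_le_one_right (Real.exp_pos _).le (min_le_left _ _)) (by positivity)
  have hG₂i : Integrable (Function.uncurry G₂)
      ((volume.restrict (Ioi 0)).prod (volume.restrict (Ioi 0))) := by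
    refine Continuous.integrable_uncurry_of_norm_le_mul measurableSet_Ioi measurableSet_Ioi
      ?_ hwα' hvβ fun p hp q hq => (hG₂_le p hp q hq).trans ?_
    · exact (hF.sub (hb.comp continuous_snd)).mul (by fun_prop)
    · exact mul_le_mul_of_nonneg_left
        (mul_le_of_le_one_right (Real.exp_pos _).le (min_le_left _ _)) (by positivity)
  rw [← setIntegral_boundaryKernel_add hX hZ hα hαβ hβ hε hb hbB,
    setIntegral_setIntegral_eq_add (f₁ := W₀) (f₂ := boundaryKernel X Z α β ε b) (f₃ := G₁)
      (f₄ := G₂) ?_ hW₀i (integrable_boundaryKernel_Ioi hX hZ hα hβ0 hε hb hbB) hG₁i hG₂i]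
  · have e₁ := norm_setIntegral_setIntegral_le_rpow measurableSet_Ioi hβ0 hβ hε
      (fun p => by positivity) (fun _ => hK) (hwα.mul_const (K ^ β)) hG₁_le
    have e₂ := norm_setIntegral_setIntegral_le_rpow measurableSet_Ioi hβ0 hβ hε
      (fun p => by positivity) (fun p => by positivity) (by
        refine ((integrableOn_exp_mul_Ioi (a := β - 1 - α) (by linarith) 0).const_mul
          (D * (X + Z) ^ β)).congr (Eventually.of_forall fun p => ?_)
        have h : Real.exp ((β - 1 - α) * p) =
            Real.exp (-p) * Real.exp (-(α * p)) * Real.exp (β * p) := by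
          rw [← Real.exp_add, ← Real.exp_add]; ring_nf
        simp only [hrpow, h]
        ring) hG₂_le
    have e₃ := norm_setIntegral_setIntegral_le_rpow measurableSet_Iic hβ0 hβ hε
      (fun p => by positivity) (fun p => by positivity) (by
        refine ((integrableOn_exp_mul_Iic (sub_pos.2 hαβ) 0).const_mul
          (B * (X + Z) ^ β)).congr (Eventually.of_forall fun p => ?_)
        have h : Real.exp ((β - α) * p) = Real.exp (-(α * p)) * Real.exp (β * p) := by
          rw [← Real.exp_add]; ring_nf
        simp only [hrpow, h]
        ring)
      (fun p _ q hq => norm_boundaryKernel_le (α := α) (β := β) hX hZ hε hbB p hq)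
    refine le_trans (le_trans (le_of_eq (congrArg norm ?_)) (norm_sub_le_of_le
      (norm_add_le_of_le e₁ e₂) e₃)) (le_of_eq ?_)
    · ring
    · ring
  · intro p q
    simp only [W₀, hG₁, hG₂, boundaryKernel, ← mul_assoc]
    push_cast
    ring

theorem exists_pos_le_norm_one_add_exp {φ : ℝ} (hφ : φ ∈ Ioo (-Real.pi) Real.pi) :
    ∃ δ : ℝ, 0 < δ ∧ ∀ u : ℝ, δ ≤ ‖1 + Complex.exp (-(u : ℂ) + Complex.I * (φ : ℂ))‖ := by
  have hc : 0 < 1 + Real.cos φ := by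
    have h : 0 < Real.cos (φ / 2) := Real.cos_pos_of_mem_Ioo
      ⟨by linarith [hφ.1], by linarith [hφ.2]⟩
    have h2 := Real.cos_sq (φ / 2)
    rw [mul_div_cancel₀ φ two_ne_zero] at h2
    nlinarith [sq_pos_of_pos h]
  refine ⟨Real.sqrt ((1 + Real.cos φ) / 2), Real.sqrt_pos.2 (by linarith), fun u => ?_⟩
  rw [Complex.norm_def]
  refine Real.sqrt_le_sqrt ?_
  have hr := Real.exp_pos (-u)
  have h1 := Real.sin_sq_add_cos_sq φ
  have hre : (1 + Complex.exp (-(u : ℂ) + Complex.I * (φ : ℂ))).re =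
      1 + Real.exp (-u) * Real.cos φ := by simp [Complex.exp_re]
  have him : (1 + Complex.exp (-(u : ℂ) + Complex.I * (φ : ℂ))).im =
      Real.exp (-u) * Real.sin φ := by simp [Complex.exp_im]
  rw [Complex.normSq_apply, hre, him]
  have h2 : (1 + Real.exp (-u) * Real.cos φ) * (1 + Real.exp (-u) * Real.cos φ) +
      Real.exp (-u) * Real.sin φ * (Real.exp (-u) * Real.sin φ) =
      (1 + Real.cos φ) / 2 * (1 + Real.exp (-u)) ^ 2 +
      (1 - Real.cos φ) / 2 * (1 - Real.exp (-u)) ^ 2 := by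
    linear_combination Real.exp (-u) ^ 2 * h1
  rw [h2]
  have h3 := Real.cos_le_one φ
  have h4 : 0 ≤ (1 - Real.cos φ) / 2 * (1 - Real.exp (-u)) ^ 2 := by
    have : 0 ≤ 1 - Real.cos φ := by linarith
    positivity
  nlinarith [mul_pos hc hr, mul_pos (mul_pos hc hr) hr]

section Vfun

variable (X Y Z α β φ₁ φ₂ : ℝ)

/-- The factor of `V(ε,-p,-q)` that stays bounded and does not depend on `ε`. -/
noncomputable def VfunAmplitude (p q : ℝ) : ℂ :=
  (Real.exp (-(X * Real.exp (-p) + Y * Real.exp (-q) + Z * Real.exp (-(p + q)))) : ℂ) /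
    ((1 + Complex.exp (-(p : ℂ) + Complex.I * (φ₁ : ℂ))) *
      (1 + Complex.exp (-(q : ℂ) + Complex.I * (φ₂ : ℂ))))

/-- The limit of `VfunAmplitude` as `p → ∞`. -/
noncomputable def VfunBoundaryAmplitude (q : ℝ) : ℂ :=
  (Real.exp (-(Y * Real.exp (-q))) : ℂ) / (1 + Complex.exp (-(q : ℂ) + Complex.I * (φ₂ : ℂ)))

theorem Vfun_neg_neg (ε p q : ℝ) :
    Vfun X Y Z α β φ₁ φ₂ ε (-p) (-q) = VfunAmplitude X Y Z φ₁ φ₂ p q *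
      ((Real.exp (-(α * p)) * Real.exp (-(β * q)) *
        Real.exp (-(ε * (2 * (X * Real.cosh p + Y * Real.cosh q + Z * Real.cosh (p + q))))) : ℝ) :
        ℂ) := by
  have h₁ : Complex.exp ((α : ℂ) * ((-p : ℝ) : ℂ) + (β : ℂ) * ((-q : ℝ) : ℂ)) =
      ((Real.exp (-(α * p)) * Real.exp (-(β * q)) : ℝ) : ℂ) := by
    rw [← Real.exp_add]; push_cast; ring_nf
  have h₂ : Real.exp (-(X * Real.exp (-p) + Y * Real.exp (-q) + Z * Real.exp (-p + -q)) -
      2 * ε * (X * Real.cosh (-p) + Y * Real.cosh (-q) + Z * Real.cosh (-p + -q))) =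
      Real.exp (-(X * Real.exp (-p) + Y * Real.exp (-q) + Z * Real.exp (-(p + q)))) *
        Real.exp (-(ε * (2 * (X * Real.cosh p + Y * Real.cosh q + Z * Real.cosh (p + q))))) := by
    rw [← Real.exp_add, ← neg_add, Real.cosh_neg, Real.cosh_neg, Real.cosh_neg]; ring_nf
  rw [Vfun, h₁, h₂, VfunAmplitude]
  push_cast
  ring

variable {X Y Z φ₁ φ₂}

theorem one_add_exp_ne_zero {φ : ℝ} (hφ : φ ∈ Ioo (-Real.pi) Real.pi) (u : ℝ) :
    1 + Complex.exp (-(u : ℂ) + Complex.I * (φ : ℂ)) ≠ 0 := by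
  obtain ⟨δ, hδ, h⟩ := exists_pos_le_norm_one_add_exp hφ
  exact norm_pos_iff.1 (hδ.trans_le (h u))

theorem continuous_VfunAmplitude (hφ₁ : φ₁ ∈ Ioo (-Real.pi) Real.pi)
    (hφ₂ : φ₂ ∈ Ioo (-Real.pi) Real.pi) :
    Continuous (Function.uncurry (VfunAmplitude X Y Z φ₁ φ₂)) := by
  unfold VfunAmplitude Function.uncurry
  exact Continuous.div (by fun_prop) (by fun_prop) fun z =>
    mul_ne_zero (one_add_exp_ne_zero hφ₁ _) (one_add_exp_ne_zero hφ₂ _)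

theorem continuous_VfunBoundaryAmplitude (hφ₂ : φ₂ ∈ Ioo (-Real.pi) Real.pi) :
    Continuous (VfunBoundaryAmplitude Y φ₂) := by
  unfold VfunBoundaryAmplitude
  exact Continuous.div (by fun_prop) (by fun_prop) (one_add_exp_ne_zero hφ₂)

theorem exists_norm_VfunBoundaryAmplitude_le (hY : 0 < Y) (hφ₂ : φ₂ ∈ Ioo (-Real.pi) Real.pi) :
    ∃ B, ∀ q, ‖VfunBoundaryAmplitude Y φ₂ q‖ ≤ B := by
  obtain ⟨δ, hδ, h⟩ := exists_pos_le_norm_one_add_exp hφ₂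
  refine ⟨1 / δ, fun q => ?_⟩
  rw [VfunBoundaryAmplitude, norm_div, Complex.norm_real, Real.norm_eq_abs, Real.abs_exp]
  refine div_le_div₀ zero_le_one (Real.exp_le_one_iff.2 ?_) hδ (h q)
  have : 0 < Y * Real.exp (-q) := by positivity
  linarith

theorem VfunAmplitude_eq_mul (p q : ℝ) :
    VfunAmplitude X Y Z φ₁ φ₂ p q = VfunBoundaryAmplitude Y φ₂ q *
      ((Real.exp (-(X * Real.exp (-p) + Z * Real.exp (-(p + q)))) : ℂ) /
        (1 + Complex.exp (-(p : ℂ) + Complex.I * (φ₁ : ℂ)))) := by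
  rw [VfunAmplitude, VfunBoundaryAmplitude, div_mul_div_comm, ← Complex.ofReal_mul, ← Real.exp_add,
    mul_comm (1 + Complex.exp (-(p : ℂ) + Complex.I * (φ₁ : ℂ)))]
  ring_nf

theorem exists_norm_VfunAmplitude_le (hX : 0 < X) (hY : 0 < Y) (hZ : 0 < Z)
    (hφ₁ : φ₁ ∈ Ioo (-Real.pi) Real.pi) (hφ₂ : φ₂ ∈ Ioo (-Real.pi) Real.pi) :
    ∃ B, ∀ p q, ‖VfunAmplitude X Y Z φ₁ φ₂ p q‖ ≤ B := by
  obtain ⟨δ, hδ, h⟩ := exists_pos_le_norm_one_add_exp hφ₁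
  obtain ⟨B, hB⟩ := exists_norm_VfunBoundaryAmplitude_le hY hφ₂
  refine ⟨B * (1 / δ), fun p q => ?_⟩
  rw [VfunAmplitude_eq_mul, norm_mul, norm_div, Complex.norm_real, Real.norm_eq_abs, Real.abs_exp]
  have : 0 < X * Real.exp (-p) + Z * Real.exp (-(p + q)) := by positivity
  exact mul_le_mul (hB q) (div_le_div₀ zero_le_one (Real.exp_le_one_iff.2 (by linarith)) hδ (h p))
    (by positivity) ((norm_nonneg _).trans (hB q))

theorem exists_norm_VfunAmplitude_sub_le (hX : 0 < X) (hY : 0 < Y) (hZ : 0 < Z)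
    (hφ₁ : φ₁ ∈ Ioo (-Real.pi) Real.pi) (hφ₂ : φ₂ ∈ Ioo (-Real.pi) Real.pi) :
    ∃ D, 0 ≤ D ∧ ∀ p, ∀ q ∈ Ioi (0 : ℝ),
      ‖VfunAmplitude X Y Z φ₁ φ₂ p q - VfunBoundaryAmplitude Y φ₂ q‖ ≤ D * Real.exp (-p) := by
  obtain ⟨δ, hδ, h⟩ := exists_pos_le_norm_one_add_exp hφ₁
  obtain ⟨B, hB⟩ := exists_norm_VfunBoundaryAmplitude_le hY hφ₂
  have hB0 : 0 ≤ B := (norm_nonneg _).trans (hB 0)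
  refine ⟨B * ((X + Z + 1) / δ), by positivity, fun p q hq => ?_⟩
  have hne := one_add_exp_ne_zero hφ₁ p
  set x := X * Real.exp (-p) + Z * Real.exp (-(p + q)) with hx
  have hx0 : 0 ≤ x := by positivity
  have hxle : x ≤ (X + Z) * Real.exp (-p) := by
    have : Real.exp (-(p + q)) ≤ Real.exp (-p) := Real.exp_le_exp.2 (by linarith [mem_Ioi.1 hq])
    rw [hx, add_mul]
    gcongr
  have h1 : ‖((Real.exp (-x) : ℂ) - 1)‖ ≤ (X + Z) * Real.exp (-p) := by
    have := (Real.abs_exp_neg_sub_exp_neg_le_min le_rfl hx0).trans (min_le_right _ _)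
    rw [neg_zero, Real.exp_zero, sub_zero] at this
    rw [← Complex.ofReal_one, ← Complex.ofReal_sub, Complex.norm_real, Real.norm_eq_abs]
    exact this.trans hxle
  have h2 : ‖Complex.exp (-(p : ℂ) + Complex.I * (φ₁ : ℂ))‖ = Real.exp (-p) := by
    simp [Complex.norm_exp]
  have h3 : VfunAmplitude X Y Z φ₁ φ₂ p q - VfunBoundaryAmplitude Y φ₂ q =
      VfunBoundaryAmplitude Y φ₂ q * ((((Real.exp (-x) : ℂ) - 1) -
        Complex.exp (-(p : ℂ) + Complex.I * (φ₁ : ℂ))) /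
        (1 + Complex.exp (-(p : ℂ) + Complex.I * (φ₁ : ℂ)))) := by
    rw [VfunAmplitude_eq_mul, ← hx]
    field_simp
    ring
  rw [h3, norm_mul, norm_div, mul_assoc]
  refine mul_le_mul (hB q) ?_ (by positivity) hB0
  rw [div_mul_eq_mul_div]
  refine div_le_div₀ (by positivity) ?_ hδ (h p)
  refine (norm_sub_le_of_le h1 h2.le).trans (le_of_eq ?_)
  ring

end Vfun

/-- Step 7 of Appendix B: as `ε → 0+`,
`∫₀^∞∫₀^∞ V(ε,−u₁,−u₂) du₁du₂ = ∫₀^∞∫₀^∞ V(0,−u₁,−u₂) du₁du₂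
  + Γ(−α)(∫₀^∞ (Ze^u+X)^α exp(−Ye^{−u}) e^{−βu}/(1+e^{−u+iφ₂}) du) ε^α + O(ε^β)`. -/
theorem Vfun_minusminus_asymptotics (X Y Z : ℝ) (hX : 0 < X) (hY : 0 < Y) (hZ : 0 < Z)
    (α β : ℝ) (hα : 0 < α) (hαβ : α < β) (hβ : β < 1) (φ₁ φ₂ : ℝ)
    (hφ₁ : φ₁ ∈ Set.Ioo (-Real.pi) Real.pi) (hφ₂ : φ₂ ∈ Set.Ioo (-Real.pi) Real.pi) :
    ∃ C ε₀ : ℝ, 0 < ε₀ ∧ ∀ ε : ℝ, 0 < ε → ε ≤ ε₀ →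
      ‖(∫ u₁ in Set.Ioi (0:ℝ), ∫ u₂ in Set.Ioi (0:ℝ), Vfun X Y Z α β φ₁ φ₂ ε (-u₁) (-u₂))
          - (∫ u₁ in Set.Ioi (0:ℝ), ∫ u₂ in Set.Ioi (0:ℝ), Vfun X Y Z α β φ₁ φ₂ 0 (-u₁) (-u₂))
          - ((Real.Gamma (-α) : ℝ) : ℂ) *
              (∫ u in Set.Ioi (0:ℝ), (((Z * Real.exp u + X) ^ α : ℝ) : ℂ) *
                (Real.exp (-(Y * Real.exp (-u))) : ℂ) * Complex.exp (-((β : ℂ) * (u : ℂ))) /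
                  (1 + Complex.exp (-(u : ℂ) + Complex.I * (φ₂ : ℂ)))) *
              ((ε ^ α : ℝ) : ℂ)‖
        ≤ C * ε ^ β := by
  obtain ⟨B₁, hB₁⟩ := exists_norm_VfunAmplitude_le hX hY hZ hφ₁ hφ₂
  obtain ⟨B₂, hB₂⟩ := exists_norm_VfunBoundaryAmplitude_le hY hφ₂
  obtain ⟨D, hD, hFb⟩ := exists_norm_VfunAmplitude_sub_le hX hY hZ hφ₁ hφ₂
  obtain ⟨C, hC⟩ := exists_norm_setIntegral_sub_boundary_le (B := max B₁ B₂) (K := X + 2 * Y + Z)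
    (A := fun p q => 2 * (X * Real.cosh p + Y * Real.cosh q + Z * Real.cosh (p + q)))
    hX hZ hα hαβ hβ hD (by positivity) (continuous_VfunAmplitude hφ₁ hφ₂)
    (by
      unfold Function.uncurry
      have := Real.continuous_cosh
      fun_prop)
    (continuous_VfunBoundaryAmplitude hφ₂) (fun p q => (hB₁ p q).trans (le_max_left _ _))
    (fun q => (hB₂ q).trans (le_max_right _ _)) (fun p _ q hq => hFb p q hq)
    (fun p q => by
      have : 0 < X * Real.exp (-p) + Y * (Real.exp q + Real.exp (-q)) +
        Z * Real.exp (-(p + q)) := by positivity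
      simp only [Real.cosh_eq, Real.exp_add p q]
      linarith)
    (fun p hp q hq => by
      rw [mem_Ioi] at hp hq
      have h₁ : Real.exp (-p) ≤ Real.exp q := Real.exp_le_exp.2 (by linarith)
      have h₂ : Real.exp (-q) ≤ Real.exp q := Real.exp_le_exp.2 (by linarith)
      have h₃ : Real.exp (-(p + q)) ≤ Real.exp q := Real.exp_le_exp.2 (by linarith)
      simp only [Real.cosh_eq, Real.exp_add p q]
      nlinarith [mul_le_mul_of_nonneg_left h₁ hX.le, mul_le_mul_of_nonneg_left h₂ hY.le,
        mul_le_mul_of_nonneg_left h₃ hZ.le])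
  refine ⟨C, 1, one_pos, fun ε hε _ => ?_⟩
  have hmain : ∀ u : ℝ, (((Z * Real.exp u + X) ^ α : ℝ) : ℂ) *
      (Real.exp (-(Y * Real.exp (-u))) : ℂ) * Complex.exp (-((β : ℂ) * (u : ℂ))) /
        (1 + Complex.exp (-(u : ℂ) + Complex.I * (φ₂ : ℂ))) =
      (((Z * Real.exp u + X) ^ α : ℝ) : ℂ) * VfunBoundaryAmplitude Y φ₂ u *
        (Real.exp (-(β * u)) : ℂ) := fun u => by
    rw [VfunBoundaryAmplitude]
    push_cast
    ring
  simp_rw [hmain, Vfun_neg_neg, zero_mul, neg_zero, Real.exp_zero, mul_one]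
  exact hC ε hε
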